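/- arXiv:1211.4346 — 2 statements merged into one kernel-verified Lean document; each statement's English description precedes it below -/
import Mathlib

section
/- Let A, B ∈ 𝓑 be disjoint, let A be nonempty, and suppose m := m(A) < ∞ (so m ≥ 1), and set ρ := ρ(A). Then for every n ∈ ℕ and every x ∈ X one has 0 ≤ w(x;A,B) − w_n(x;A,B) ≤ (m/(1−ρ))·ρ^⌊n/m⌋. -/
open MeasureTheory ProbabilityTheory

variable {X : Type*} [MeasurableSpace X]

/-- Transition operator: `(Pf)(x) = ∫ f(y) P(x,dy)`. -/
noncomputable def transOp (P : Kernel X X) (f : X → ℝ) : X → ℝ :=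
  fun x => ∫ y, f y ∂(P x)

/-- Invariance operator `I_A f = 1_A · (Pf)`. -/
noncomputable def invOp (P : Kernel X X) (A : Set X) (f : X → ℝ) : X → ℝ :=
  A.indicator (transOp P f)

/-- Invariance value functions `u_n(·;A)`. -/
noncomputable def uN (P : Kernel X X) (A : Set X) : ℕ → X → ℝ
  | 0 => A.indicator 1
  | n + 1 => invOp P A (uN P A n)

/-- `u(x;A) = lim_n u_n(x;A)` (the sequence is pointwise nonincreasing). -/
noncomputable def uFun (P : Kernel X X) (A : Set X) : X → ℝ :=
  fun x => ⨅ n, uN P A n x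

/-- Reach-avoid value functions `w_n(·;A,B)`. -/
noncomputable def wN (P : Kernel X X) (A B : Set X) : ℕ → X → ℝ
  | 0 => B.indicator 1
  | n + 1 => fun x => B.indicator 1 x + invOp P (A \ B) (wN P A B n) x

/-- `w(x;A,B) = lim_n w_n(x;A,B)` (the sequence is pointwise nondecreasing, in `[0,1]`). -/
noncomputable def wFun (P : Kernel X X) (A B : Set X) : X → ℝ :=
  fun x => ⨆ n, wN P A B n x

/-- A bounded function. -/
def BddFun (f : X → ℝ) : Prop := ∃ C : ℝ, ∀ x, |f x| ≤ C

/-- A set `S` is absorbing if `P(x,S) = 1` for all `x ∈ S`. -/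
def Absorbing (P : Kernel X X) (S : Set X) : Prop := ∀ x ∈ S, P x S = 1

/-- A set is simple if its only absorbing measurable subset is empty. -/
def Simple (P : Kernel X X) (A : Set X) : Prop :=
  ∀ S ⊆ A, MeasurableSet S → Absorbing P S → S = ∅


lemma integrable_of_mem_Icc (P : Kernel X X) [IsMarkovKernel P] {f : X → ℝ}
    (hf : Measurable f) (hf01 : ∀ x, f x ∈ Set.Icc (0 : ℝ) 1) (x : X) :
    Integrable f (P x) :=
  Integrable.of_bound hf.aestronglyMeasurable 1 (ae_of_all _ fun y => by
    rw [Real.norm_eq_abs, abs_of_nonneg (hf01 y).1]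
    exact (hf01 y).2)

lemma measurable_invOp (P : Kernel X X) [IsMarkovKernel P] {A : Set X} (hA : MeasurableSet A)
    {f : X → ℝ} (hf : Measurable f) : Measurable (invOp P A f) :=
  (hf.stronglyMeasurable.integral_kernel (κ := P)).measurable.indicator hA

lemma invOp_mono (P : Kernel X X) (A : Set X) {f g : X → ℝ} (hf : ∀ x, Integrable f (P x))
    (hg : ∀ x, Integrable g (P x)) (hfg : ∀ x, f x ≤ g x) (x : X) :
    invOp P A f x ≤ invOp P A g x :=
  Set.indicator_le_indicator (integral_mono (hf x) (hg x) hfg)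

lemma invOp_const_mul (P : Kernel X X) (A : Set X) (c : ℝ) (f : X → ℝ) (x : X) :
    invOp P A (fun y => c * f y) x = c * invOp P A f x := by
  by_cases hx : x ∈ A <;> simp [invOp, transOp, hx, integral_const_mul]

lemma invOp_sub (P : Kernel X X) (A : Set X) {f g : X → ℝ} (hf : ∀ x, Integrable f (P x))
    (hg : ∀ x, Integrable g (P x)) (x : X) :
    invOp P A (fun y => f y - g y) x = invOp P A f x - invOp P A g x := by
  by_cases hx : x ∈ A <;> simp [invOp, transOp, hx, integral_sub (hf x) (hg x)]

lemma invOp_mem_Icc (P : Kernel X X) [IsMarkovKernel P] (A : Set X) {f : X → ℝ}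
    (hf : Measurable f) (hf01 : ∀ x, f x ∈ Set.Icc (0 : ℝ) 1) (x : X) :
    invOp P A f x ∈ Set.Icc (0 : ℝ) (A.indicator 1 x) := by
  by_cases hx : x ∈ A
  · simp only [invOp, transOp, hx, Set.indicator_of_mem, Pi.one_apply]
    refine ⟨integral_nonneg fun y => (hf01 y).1, ?_⟩
    calc ∫ y, f y ∂(P x) ≤ ∫ _, (1 : ℝ) ∂(P x) :=
          integral_mono (integrable_of_mem_Icc P hf hf01 x) (integrable_const _)
            fun y => (hf01 y).2
      _ = 1 := by simp
  · simp [invOp, hx]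

lemma indicator_one_mem_Icc {Y : Type*} (A : Set Y) (x : Y) :
    A.indicator (1 : Y → ℝ) x ∈ Set.Icc (0 : ℝ) 1 := by
  by_cases hx : x ∈ A <;> simp [hx]

lemma uN_measurable_mem_Icc (P : Kernel X X) [IsMarkovKernel P] {A : Set X}
    (hA : MeasurableSet A) (n : ℕ) :
    Measurable (uN P A n) ∧ ∀ x, uN P A n x ∈ Set.Icc (0 : ℝ) (A.indicator 1 x) := by
  induction n with
  | zero =>
    exact ⟨measurable_one.indicator hA, fun x => ⟨(indicator_one_mem_Icc A x).1, le_rfl⟩⟩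
  | succ n ih =>
    exact ⟨measurable_invOp P hA ih.1, invOp_mem_Icc P A ih.1 fun x =>
      ⟨(ih.2 x).1, (ih.2 x).2.trans (indicator_one_mem_Icc A x).2⟩⟩

lemma uN_mem_Icc (P : Kernel X X) [IsMarkovKernel P] {A : Set X}
    (hA : MeasurableSet A) (n : ℕ) (x : X) : uN P A n x ∈ Set.Icc (0 : ℝ) 1 :=
  ⟨((uN_measurable_mem_Icc P hA n).2 x).1,
    ((uN_measurable_mem_Icc P hA n).2 x).2.trans (indicator_one_mem_Icc A x).2⟩

lemma integrable_uN (P : Kernel X X) [IsMarkovKernel P] {A : Set X} (hA : MeasurableSet A)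
    (n : ℕ) (x : X) : Integrable (uN P A n) (P x) :=
  integrable_of_mem_Icc P (uN_measurable_mem_Icc P hA n).1 (uN_mem_Icc P hA n) x

lemma uN_add_le (P : Kernel X X) [IsMarkovKernel P] {A : Set X} (hA : MeasurableSet A)
    {m : ℕ} {ρ : ℝ} (hρ : ∀ x, uN P A m x ≤ ρ) (n : ℕ) (x : X) :
    uN P A (n + m) x ≤ ρ * uN P A n x := by
  induction n generalizing x with
  | zero =>
    rw [Nat.zero_add]
    by_cases hx : x ∈ A
    · simpa [uN, hx] using hρ x
    · simpa [uN, hx] using ((uN_measurable_mem_Icc P hA m).2 x).2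
  | succ n ih =>
    rw [Nat.add_right_comm]
    change invOp P A (uN P A (n + m)) x ≤ ρ * invOp P A (uN P A n) x
    rw [← invOp_const_mul]
    exact invOp_mono P A (integrable_uN P hA _) (fun y => (integrable_uN P hA n y).const_mul ρ)
      ih x

lemma uN_le_pow (P : Kernel X X) [IsMarkovKernel P] {A : Set X} (hA : MeasurableSet A)
    {m : ℕ} {ρ : ℝ} (hρ0 : 0 ≤ ρ) (hρ : ∀ x, uN P A m x ≤ ρ) (n : ℕ) (x : X) :
    uN P A n x ≤ ρ ^ (n / m) := by
  have key : ∀ q r : ℕ, uN P A (r + m * q) x ≤ ρ ^ q := fun q r => by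
    induction q with
    | zero => simpa using (uN_mem_Icc P hA r x).2
    | succ q ih =>
      rw [Nat.mul_succ, ← Nat.add_assoc, pow_succ']
      exact (uN_add_le P hA hρ _ x).trans (mul_le_mul_of_nonneg_left ih hρ0)
  simpa only [Nat.mod_add_div] using key (n / m) (n % m)

lemma wN_measurable_mem_Icc (P : Kernel X X) [IsMarkovKernel P] {A B : Set X}
    (hA : MeasurableSet A) (hB : MeasurableSet B) (n : ℕ) :
    Measurable (wN P A B n) ∧ ∀ x, wN P A B n x ∈ Set.Icc (0 : ℝ) 1 := by
  induction n with
  | zero => exact ⟨measurable_one.indicator hB, indicator_one_mem_Icc B⟩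
  | succ n ih =>
    refine ⟨(measurable_one.indicator hB).add (measurable_invOp P (hA.diff hB) ih.1),
      fun x => ?_⟩
    have h := invOp_mem_Icc P (A \ B) ih.1 ih.2 x
    change B.indicator 1 x + invOp P (A \ B) (wN P A B n) x ∈ Set.Icc (0 : ℝ) 1
    by_cases hx : x ∈ B
    · simp [hx, invOp]
    · have h' := (indicator_one_mem_Icc (A \ B) x).2
      simpa [hx] using (⟨h.1, h.2.trans h'⟩ : _ ∈ Set.Icc (0 : ℝ) 1)

lemma integrable_wN (P : Kernel X X) [IsMarkovKernel P] {A B : Set X}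
    (hA : MeasurableSet A) (hB : MeasurableSet B) (n : ℕ) (x : X) :
    Integrable (wN P A B n) (P x) :=
  integrable_of_mem_Icc P (wN_measurable_mem_Icc P hA hB n).1
    (wN_measurable_mem_Icc P hA hB n).2 x

lemma wN_succ_sub_mem_Icc (P : Kernel X X) [IsMarkovKernel P] {A B : Set X}
    (hA : MeasurableSet A) (hB : MeasurableSet B) (hAB : Disjoint A B) (n : ℕ) (x : X) :
    wN P A B (n + 1) x - wN P A B n x ∈ Set.Icc (0 : ℝ) (uN P A n x) := by
  induction n generalizing x with
  | zero =>
    have h := invOp_mem_Icc P A (measurable_one.indicator hB) (indicator_one_mem_Icc B) x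
    simpa [wN, uN, hAB.sdiff_eq_left] using h
  | succ n ih =>
    have hd : wN P A B (n + 1 + 1) x - wN P A B (n + 1) x
        = invOp P A (fun y => wN P A B (n + 1) y - wN P A B n y) x := by
      rw [invOp_sub P A (integrable_wN P hA hB _) (integrable_wN P hA hB _)]
      change (B.indicator 1 x + invOp P (A \ B) (wN P A B (n + 1)) x)
        - (B.indicator 1 x + invOp P (A \ B) (wN P A B n) x) = _
      rw [hAB.sdiff_eq_left]
      ring
    rw [hd]
    exact ⟨Set.indicator_nonneg (fun z _ => integral_nonneg fun y => (ih y).1) x,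
      invOp_mono P A
        (fun y => (integrable_wN P hA hB (n + 1) y).sub (integrable_wN P hA hB n y))
        (integrable_uN P hA n) (fun y => (ih y).2) x⟩

lemma sum_uN_le (P : Kernel X X) [IsMarkovKernel P] {A : Set X} (hA : MeasurableSet A)
    {m : ℕ} {ρ : ℝ} (hρ0 : 0 ≤ ρ) (hρ1 : ρ < 1) (hρ : ∀ x, uN P A m x ≤ ρ) (n N : ℕ) (x : X) :
    ∑ k ∈ Finset.range N, uN P A (n + k) x ≤ (m : ℝ) / (1 - ρ) * ρ ^ (n / m) := by
  have hinit : ∑ k ∈ Finset.range m, uN P A (n + k) x ≤ m * ρ ^ (n / m) := by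
    have h := Finset.sum_le_card_nsmul (Finset.range m) (fun k => uN P A (n + k) x)
      (ρ ^ (n / m)) fun k _ => (uN_le_pow P hA hρ0 hρ (n + k) x).trans
        (pow_le_pow_of_le_one hρ0 hρ1.le (Nat.div_le_div_right (Nat.le_add_right n k)))
    simpa using h
  have htail : ∑ k ∈ Finset.range N, uN P A (n + (m + k)) x
      ≤ ρ * ∑ k ∈ Finset.range N, uN P A (n + k) x := by
    rw [Finset.mul_sum]
    refine Finset.sum_le_sum fun k _ => ?_
    rw [Nat.add_comm m k, ← Nat.add_assoc]
    exact uN_add_le P hA hρ (n + k) x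
  have hmono : ∑ k ∈ Finset.range N, uN P A (n + k) x
      ≤ ∑ k ∈ Finset.range (m + N), uN P A (n + k) x :=
    Finset.sum_le_sum_of_subset_of_nonneg (Finset.range_mono (Nat.le_add_left N m))
      fun k _ _ => (uN_mem_Icc P hA (n + k) x).1
  rw [Finset.sum_range_add] at hmono
  rw [div_mul_eq_mul_div, le_div_iff₀ (sub_pos.2 hρ1)]
  linarith

/-- if `A, B` are disjoint, `A` nonempty, `m := m(A) < ∞` and `ρ := ρ(A)`, then
`0 ≤ w(x;A,B) − w_n(x;A,B) ≤ (m/(1−ρ))·ρ^⌊n/m⌋` for every `n` and `x`. -/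
theorem stmt3 (P : Kernel X X) [IsMarkovKernel P] (A B : Set X)
    (hA : MeasurableSet A) (hB : MeasurableSet B) (hAB : Disjoint A B) (hne : A.Nonempty)
    (hfin : {k : ℕ | (⨆ x, uN P A k x) < 1}.Nonempty)
    (m : ℕ) (hm : m = sInf {k : ℕ | (⨆ x, uN P A k x) < 1})
    (ρ : ℝ) (hρ : ρ = ⨆ x, uN P A m x) :
    ∀ (n : ℕ) (x : X),
      0 ≤ wFun P A B x - wN P A B n x ∧
        wFun P A B x - wN P A B n x ≤ ((m : ℝ) / (1 - ρ)) * ρ ^ (n / m) := by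
  have hbdd : ∀ k, BddAbove (Set.range (uN P A k)) := fun k =>
    ⟨1, Set.forall_mem_range.2 fun x => (uN_mem_Icc P hA k x).2⟩
  have hρ1 : ρ < 1 := by
    have h := Nat.sInf_mem hfin
    rw [← hm] at h
    exact hρ ▸ h
  have hle : ∀ x, uN P A m x ≤ ρ := fun x => hρ ▸ le_ciSup (hbdd m) x
  have hρ0 : 0 ≤ ρ := (uN_mem_Icc P hA m hne.some).1.trans (hle _)
  intro n x
  have hwbdd : BddAbove (Set.range fun k => wN P A B k x) :=
    ⟨1, Set.forall_mem_range.2 fun k => ((wN_measurable_mem_Icc P hA hB k).2 x).2⟩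
  have hmono : Monotone fun k => wN P A B k x := monotone_nat_of_le_succ fun k =>
    sub_nonneg.1 (wN_succ_sub_mem_Icc P hA hB hAB k x).1
  refine ⟨sub_nonneg.2 (le_ciSup hwbdd n), ?_⟩
  rw [sub_le_iff_le_add]
  refine ciSup_le fun N => (hmono (Nat.le_add_left N n)).trans ?_
  rw [← sub_le_iff_le_add]
  refine le_trans ?_ (sum_uN_le P hA hρ0 hρ1 hle n N x)
  have htel := Finset.sum_range_sub (fun k => wN P A B (n + k) x) N
  rw [Nat.add_zero] at htel
  rw [← htel]
  exact Finset.sum_le_sum fun k _ => (wN_succ_sub_mem_Icc P hA hB hAB (n + k) x).2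
end

section
/- Suppose X is a Borel subset of a Polish space with its Borel σ-algebra 𝓑 and P is a Markov kernel. Let A ∈ 𝓑 be compact and such that x ↦ P(x,D) is continuous on A for every measurable D ⊆ A. Then for every B ∈ 𝓑 disjoint from A one has m(A \ l.a.s.(A)) < ∞ and w(x;A,B) = w(x; A \ l.a.s.(A), B) for all x ∈ X. -/
open MeasureTheory ProbabilityTheory

variable {X : Type*} [MeasurableSpace X]

theorem transOp_nonneg (P : Kernel X X) {f : X → ℝ} (h0 : ∀ x, 0 ≤ f x) (x : X) :
    0 ≤ transOp P f x :=
  integral_nonneg h0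

theorem integrable_of_mem_Icc_s17 {μ : Measure X} [IsFiniteMeasure μ] {f : X → ℝ} (hf : Measurable f)
    (h0 : ∀ x, 0 ≤ f x) (h1 : ∀ x, f x ≤ 1) : Integrable f μ :=
  Integrable.of_bound hf.aestronglyMeasurable 1
    (.of_forall fun x => by rw [Real.norm_of_nonneg (h0 x)]; exact h1 x)

theorem transOp_mono (P : Kernel X X) [IsMarkovKernel P] {f g : X → ℝ}
    (hf : Measurable f) (hf0 : ∀ x, 0 ≤ f x) (hf1 : ∀ x, f x ≤ 1)
    (hg : Measurable g) (hg0 : ∀ x, 0 ≤ g x) (hg1 : ∀ x, g x ≤ 1)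
    (hfg : ∀ x, f x ≤ g x) (x : X) : transOp P f x ≤ transOp P g x :=
  integral_mono (integrable_of_mem_Icc_s17 hf hf0 hf1) (integrable_of_mem_Icc_s17 hg hg0 hg1) hfg

theorem transOp_le_one (P : Kernel X X) [IsMarkovKernel P] {f : X → ℝ}
    (hf : Measurable f) (h0 : ∀ x, 0 ≤ f x) (h1 : ∀ x, f x ≤ 1) (x : X) :
    transOp P f x ≤ 1 := by
  have := integral_mono (μ := P x) (integrable_of_mem_Icc_s17 hf h0 h1) (integrable_const 1) h1
  simpa [transOp] using this

theorem ae_eq_one_of_transOp_eq_one (P : Kernel X X) [IsMarkovKernel P] {f : X → ℝ}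
    (hf : Measurable f) (h0 : ∀ x, 0 ≤ f x) (h1 : ∀ x, f x ≤ 1) {x : X}
    (hx : transOp P f x = 1) : ∀ᵐ y ∂(P x), f y = 1 := by
  have hi : Integrable f (P x) := integrable_of_mem_Icc_s17 hf h0 h1
  have hz : ∫ y, (1 - f y) ∂(P x) = 0 := by
    rw [integral_sub (integrable_const 1) hi]
    rw [transOp] at hx
    simp [hx]
  have := (integral_eq_zero_iff_of_nonneg (fun y => sub_nonneg.2 (h1 y))
    ((integrable_const 1).sub hi)).1 hz
  filter_upwards [this] with y hy
  simp only [Pi.zero_apply] at hy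
  linarith

theorem measurable_transOp (P : Kernel X X) [IsMarkovKernel P] {f : X → ℝ}
    (hf : Measurable f) : Measurable (transOp P f) :=
  (hf.stronglyMeasurable.integral_kernel (κ := P)).measurable

theorem uN_nonneg (P : Kernel X X) (A : Set X) (n : ℕ) (x : X) : 0 ≤ uN P A n x := by
  induction n generalizing x with
  | zero => exact Set.indicator_nonneg (fun _ _ => zero_le_one) x
  | succ n ih => exact Set.indicator_nonneg (fun y _ => transOp_nonneg P ih y) x

theorem uN_eq_zero_of_notMem (P : Kernel X X) {A : Set X} (n : ℕ) {x : X} (hx : x ∉ A) :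
    uN P A n x = 0 := by
  cases n <;> exact Set.indicator_of_notMem hx _

theorem uN_succ_of_mem (P : Kernel X X) {A : Set X} (n : ℕ) {x : X} (hx : x ∈ A) :
    uN P A (n + 1) x = transOp P (uN P A n) x :=
  Set.indicator_of_mem hx _

section Markov

variable (P : Kernel X X) [IsMarkovKernel P] {A : Set X}

theorem measurable_uN (hA : MeasurableSet A) (n : ℕ) : Measurable (uN P A n) := by
  induction n with
  | zero => exact measurable_one.indicator hA
  | succ n ih => exact (measurable_transOp P ih).indicator hA

theorem uN_le_one (hA : MeasurableSet A) (n : ℕ) (x : X) : uN P A n x ≤ 1 := by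
  induction n generalizing x with
  | zero => exact Set.indicator_le_self' (fun _ _ => zero_le_one) x
  | succ n ih =>
    by_cases hx : x ∈ A
    · rw [uN_succ_of_mem P n hx]
      exact transOp_le_one P (measurable_uN P hA n) (uN_nonneg P A n) ih x
    · rw [uN_eq_zero_of_notMem P _ hx]
      exact zero_le_one

theorem uN_succ_le (hA : MeasurableSet A) (n : ℕ) (x : X) : uN P A (n + 1) x ≤ uN P A n x := by
  induction n generalizing x with
  | zero =>
    by_cases hx : x ∈ A
    · simpa [uN, hx] using uN_le_one P hA 1 x
    · simp [uN_eq_zero_of_notMem P _ hx]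
  | succ n ih =>
    by_cases hx : x ∈ A
    · rw [uN_succ_of_mem P _ hx, uN_succ_of_mem P _ hx]
      exact transOp_mono P (measurable_uN P hA _) (uN_nonneg P A _) (uN_le_one P hA _)
        (measurable_uN P hA _) (uN_nonneg P A _) (uN_le_one P hA _) ih x
    · simp [uN_eq_zero_of_notMem P _ hx]

theorem uN_mono_set {A' : Set X} (hA' : MeasurableSet A') (hA : MeasurableSet A) (h : A' ⊆ A)
    (n : ℕ) (x : X) : uN P A' n x ≤ uN P A n x := by
  induction n generalizing x with
  | zero => exact Set.indicator_le_indicator_of_subset h (fun _ => zero_le_one) x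
  | succ n ih =>
    by_cases hx : x ∈ A'
    · rw [uN_succ_of_mem P _ hx, uN_succ_of_mem P _ (h hx)]
      exact transOp_mono P (measurable_uN P hA' _) (uN_nonneg P A' _) (uN_le_one P hA' _)
        (measurable_uN P hA _) (uN_nonneg P A _) (uN_le_one P hA _) ih x
    · rw [uN_eq_zero_of_notMem P _ hx]
      exact uN_nonneg P A _ x

theorem uFun_eq_one_iff (hA : MeasurableSet A) (x : X) :
    uFun P A x = 1 ↔ ∀ n, uN P A n x = 1 := by
  have hb : BddBelow (Set.range fun n => uN P A n x) :=
    ⟨0, Set.forall_mem_range.2 fun n => uN_nonneg P A n x⟩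
  constructor
  · exact fun h n => (uN_le_one P hA n x).antisymm (h ▸ ciInf_le hb n)
  · intro h
    simp [uFun, h]

theorem mem_of_uFun_eq_one (hA : MeasurableSet A) {x : X} (hx : uFun P A x = 1) : x ∈ A := by
  by_contra h
  have := (uFun_eq_one_iff P hA x).1 hx 0
  rw [uN_eq_zero_of_notMem P 0 h] at this
  exact zero_ne_one this

theorem measurableSet_uFun_eq_one (hA : MeasurableSet A) :
    MeasurableSet {x | uFun P A x = 1} :=
  (Measurable.iInf fun n => measurable_uN P hA n) (measurableSet_singleton 1)

theorem ae_uFun_eq_one (hA : MeasurableSet A) {x : X}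
    (hx : ∀ n, transOp P (uN P A n) x = 1) : ∀ᵐ y ∂(P x), uFun P A y = 1 := by
  have : ∀ᵐ y ∂(P x), ∀ n, uN P A n y = 1 := ae_all_iff.2 fun n =>
    ae_eq_one_of_transOp_eq_one P (measurable_uN P hA n) (uN_nonneg P A n) (uN_le_one P hA n) (hx n)
  filter_upwards [this] with y hy
  exact (uFun_eq_one_iff P hA y).2 hy

/-- The set `{u(·;A) = 1}` is absorbing, in almost-everywhere form. -/
theorem ae_uFun_eq_one_of_uFun_eq_one (hA : MeasurableSet A) {x : X} (hx : uFun P A x = 1) :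
    ∀ᵐ y ∂(P x), uFun P A y = 1 :=
  ae_uFun_eq_one P hA fun n => by
    rw [← uN_succ_of_mem P n (mem_of_uFun_eq_one P hA hx)]
    exact (uFun_eq_one_iff P hA x).1 hx _

/-- Removing `{u(·;A) = 1}` from `A` leaves a set from which no point has
an almost surely surviving successor. -/
theorem exists_transOp_uN_diff_ne_one (hA : MeasurableSet A) (x : X) :
    ∃ n, transOp P (uN P (A \ {x | uFun P A x = 1}) n) x ≠ 1 := by
  by_contra! h
  have hA' := hA.diff (measurableSet_uFun_eq_one P hA)
  obtain ⟨y, hy⟩ := (ae_uFun_eq_one P hA' h).exists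
  refine (mem_of_uFun_eq_one P hA' hy).2 ((uFun_eq_one_iff P hA y).2 fun n => ?_)
  refine (uN_le_one P hA n y).antisymm ?_
  rw [← (uFun_eq_one_iff P hA' y).1 hy n]
  exact uN_mono_set P hA' hA Set.sdiff_subset n y

theorem wN_eq_zero_of_uFun_eq_one (hA : MeasurableSet A) {B : Set X} (hAB : Disjoint A B) (n : ℕ)
    {x : X} (hx : uFun P A x = 1) : wN P A B n x = 0 := by
  have hB : ∀ {y}, uFun P A y = 1 → y ∉ B := fun hy =>
    Set.disjoint_left.1 hAB (mem_of_uFun_eq_one P hA hy)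
  induction n generalizing x with
  | zero => exact Set.indicator_of_notMem (hB hx) _
  | succ n ih =>
    have h0 : transOp P (wN P A B n) x = 0 := integral_eq_zero_of_ae <| by
      filter_upwards [ae_uFun_eq_one_of_uFun_eq_one P hA hx] with y hy using ih hy
    simp [wN, invOp, hB hx, h0]

theorem wN_diff_uFun_eq_one (hA : MeasurableSet A) {B : Set X} (hAB : Disjoint A B) (n : ℕ) :
    wN P A B n = wN P (A \ {x | uFun P A x = 1}) B n := by
  induction n with
  | zero => rfl
  | succ n ih =>
    funext x
    by_cases hx : uFun P A x = 1
    · have hB := Set.disjoint_left.1 hAB (mem_of_uFun_eq_one P hA hx)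
      rw [wN_eq_zero_of_uFun_eq_one P hA hAB _ hx]
      simp [wN, invOp, hx, hB]
    · classical
      simp [wN, invOp, ← ih, Set.indicator_apply, hx]

/-- If `x ↦ P(x,D)` is continuous on `A` for all measurable `D ⊆ A`, then so is `Pf` for every
measurable `f` with values in `[0,1]` that vanishes off `A`. -/
theorem continuousOn_transOp [TopologicalSpace X] [FirstCountableTopology X]
    (hcont : ∀ D : Set X, D ⊆ A → MeasurableSet D →
      ContinuousOn (fun x => (P x D).toReal) A)
    {f : X → ℝ} (hf : Measurable f) (h0 : ∀ x, 0 ≤ f x) (h1 : ∀ x, f x ≤ 1)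
    (hfA : ∀ x, x ∉ A → f x = 0) : ContinuousOn (transOp P f) A := by
  have key : ∀ x, transOp P f x = ∫ t in Set.Ioi (0 : ℝ), (P x).real {a | t < f a} := fun x =>
    (integrable_of_mem_Icc_s17 hf h0 h1).integral_eq_integral_meas_lt (.of_forall h0)
  have : ContinuousOn
      (fun x => ∫ t in Set.Ioi (0 : ℝ), (P x).real {a | t < f a}) A := by
    refine continuousOn_of_dominated (bound := (Set.Iic (1 : ℝ)).indicator 1) ?_ ?_ ?_ ?_
    · intro x _
      refine (Antitone.measurable fun s t hst => ?_).aestronglyMeasurable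
      exact measureReal_mono fun a (ha : t < f a) => hst.trans_lt ha
    · refine fun x _ => .of_forall fun t => ?_
      rw [Real.norm_of_nonneg measureReal_nonneg]
      by_cases ht : t ≤ 1
      · simp [ht]
      · have : {a | t < f a} = ∅ :=
          Set.eq_empty_of_forall_notMem fun a (ha : t < f a) => ht (ha.le.trans (h1 a))
        simp [this, ht]
    · rw [integrable_indicator_iff measurableSet_Iic, IntegrableOn,
        Measure.restrict_restrict measurableSet_Iic, Set.Iic_inter_Ioi]
      exact integrable_const 1
    · filter_upwards [ae_restrict_mem measurableSet_Ioi] with t ht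
      refine hcont _ (fun a (ha : t < f a) => ?_) (measurableSet_lt measurable_const hf)
      by_contra hn
      rw [hfA a hn] at ha
      exact lt_asymm ht ha
  exact this.congr fun x _ => key x

/-- On a compact set, the functions `u_n` of the complement of `{u(·;A) = 1}` are eventually
bounded away from `1`. -/
theorem exists_iSup_uN_diff_lt_one [TopologicalSpace X] [FirstCountableTopology X]
    (hA : MeasurableSet A) (hAcp : IsCompact A)
    (hcont : ∀ D : Set X, D ⊆ A → MeasurableSet D →
      ContinuousOn (fun x => (P x D).toReal) A) :
    ∃ k, (⨆ x, uN P (A \ {x | uFun P A x = 1}) k x) < 1 := by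
  set A' := A \ {x | uFun P A x = 1}
  have hA' : MeasurableSet A' := hA.diff (measurableSet_uFun_eq_one P hA)
  have hsub : A' ⊆ A := Set.sdiff_subset
  have hg : ∀ n, ContinuousOn (transOp P (uN P A' n)) A := fun n =>
    continuousOn_transOp P hcont (measurable_uN P hA' n) (uN_nonneg P A' n) (uN_le_one P hA' n)
      fun x hx => uN_eq_zero_of_notMem P n fun h => hx (hsub h)
  have hle : ∀ n x, transOp P (uN P A' n) x ≤ 1 := fun n =>
    transOp_le_one P (measurable_uN P hA' n) (uN_nonneg P A' n) (uN_le_one P hA' n)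
  have hanti : ∀ x, Antitone fun n => transOp P (uN P A' n) x := fun x =>
    antitone_nat_of_succ_le fun n =>
      transOp_mono P (measurable_uN P hA' _) (uN_nonneg P A' _) (uN_le_one P hA' _)
        (measurable_uN P hA' _) (uN_nonneg P A' _) (uN_le_one P hA' _) (uN_succ_le P hA' n) x
  obtain ⟨n, hn⟩ : ∃ n, ∀ x ∈ A, transOp P (uN P A' n) x < 1 := by
    choose! U hUo hU using fun n => (continuousOn_iff'.1 (hg n)) (Set.Iio 1) isOpen_Iio
    obtain ⟨n, hn⟩ := hAcp.elim_directed_cover (fun n => ⋃ m ≤ n, U m)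
      (fun n => isOpen_biUnion fun m _ => hUo m)
      (fun x hx => by
        obtain ⟨n, hn⟩ := exists_transOp_uN_diff_ne_one P hA x
        have hlt : transOp P (uN P A' n) x < 1 := lt_of_le_of_ne (hle n x) hn
        have : x ∈ U n ∩ A := hU n ▸ ⟨hlt, hx⟩
        exact Set.mem_iUnion.2 ⟨n, Set.mem_biUnion (le_refl n) this.1⟩)
      (Monotone.directed_le fun m n hmn =>
        Set.biUnion_subset_biUnion_left fun k (hk : k ≤ m) => hk.trans hmn)
    refine ⟨n, fun x hx => ?_⟩
    obtain ⟨m, hmn, hm⟩ := Set.mem_iUnion₂.1 (hn hx)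
    have : x ∈ transOp P (uN P A' m) ⁻¹' Set.Iio 1 ∩ A := hU m ▸ ⟨hm, hx⟩
    exact (hanti x hmn).trans_lt this.1
  refine ⟨n + 1, ?_⟩
  obtain ⟨M, hM0, hM1, hM⟩ : ∃ M : ℝ, 0 ≤ M ∧ M < 1 ∧ ∀ x ∈ A, transOp P (uN P A' n) x ≤ M := by
    rcases A.eq_empty_or_nonempty with rfl | hne
    · exact ⟨0, le_rfl, zero_lt_one, by simp⟩
    · obtain ⟨z, hz, hmax⟩ := hAcp.exists_isMaxOn hne (hg n)
      exact ⟨_, transOp_nonneg P (uN_nonneg P A' n) z, hn z hz, fun x hx => hmax hx⟩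
  refine (Real.iSup_le (fun x => ?_) hM0).trans_lt hM1
  by_cases hx : x ∈ A'
  · rw [uN_succ_of_mem P n hx]
    exact hM x (hsub hx)
  · rwa [uN_eq_zero_of_notMem P _ hx]

end Markov

/-- on a Borel subset of a Polish space, if `A` is compact and `x ↦ P(x,D)` is
continuous on `A` for every measurable `D ⊆ A`, then for every `B` disjoint from `A` one has
`m(A \ l.a.s.(A)) < ∞` and `w(x;A,B) = w(x;A \ l.a.s.(A),B)` for all `x`,
where `l.a.s.(A) = {x : u(x;A) = 1}`. -/
theorem stmt17 {Y : Type*} [TopologicalSpace Y] [PolishSpace Y]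
    [MeasurableSpace Y] [BorelSpace Y] {X₀ : Set Y} (hX₀ : MeasurableSet X₀)
    (P : Kernel ↥X₀ ↥X₀) [IsMarkovKernel P]
    (A : Set ↥X₀) (hA : MeasurableSet A) (hAcp : IsCompact A)
    (hcont : ∀ D : Set ↥X₀, D ⊆ A → MeasurableSet D →
      ContinuousOn (fun x => (P x D).toReal) A)
    (B : Set ↥X₀) (hB : MeasurableSet B) (hAB : Disjoint A B) :
    {k : ℕ | (⨆ x, uN P (A \ {x | uFun P A x = 1}) k x) < 1}.Nonempty ∧
      ∀ x, wFun P A B x = wFun P (A \ {x | uFun P A x = 1}) B x := by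
  refine ⟨exists_iSup_uN_diff_lt_one P hA hAcp hcont, fun x => ?_⟩
  simp only [wFun, ← wN_diff_uFun_eq_one P hA hAB]
end
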